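/- arXiv:2407.07677 — 6 statements merged into one kernel-verified Lean document; each statement's English description precedes it below -/
import Mathlib

section
/- Let a GCBP instance be given with n ≥ 2 items of sizes s_i ∈ [0,1] and cost function f. Suppose f(j)/j ≥ f(2)/2 for every j ∈ {1,…,n}. Then there exists a feasible solution of minimum cost in which at most one bin has cardinality at least 3, this bin (if it exists) has odd cardinality, and every other bin has cardinality 1 or 2. -/
open Finset

/-- `R` is a partition of `U` into nonempty bins of total size at most one. -/
def FeasOn {α : Type*} [DecidableEq α] (s : α → ℚ) (U : Finset α) (R : Finset (Finset α)) : Prop :=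
  (∀ C ∈ R, C.Nonempty ∧ C ⊆ U ∧ ∑ i ∈ C, s i ≤ 1) ∧ ∀ i ∈ U, ∃! C, C ∈ R ∧ i ∈ C

/-- `R` is a feasible partition of `U` into pairs. -/
def PairsOn {α : Type*} [DecidableEq α] (s : α → ℚ) (U : Finset α) (R : Finset (Finset α)) : Prop :=
  FeasOn s U R ∧ (∀ C ∈ R, C.card = 2) ∧ 2 * R.card = U.card

section aux
variable {α : Type*} [DecidableEq α] {s : α → ℚ}

lemma FeasOn.disj {U V : Finset α} {R Q : Finset (Finset α)}
    (h1 : FeasOn s U R) (h2 : FeasOn s V Q) (hd : Disjoint U V) : Disjoint R Q := by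
  rw [Finset.disjoint_left]
  intro C hC hC'
  obtain ⟨i, hi⟩ := (h1.1 C hC).1
  exact Finset.disjoint_left.1 hd ((h1.1 C hC).2.1 hi) ((h2.1 C hC').2.1 hi)

lemma FeasOn.glue {U V : Finset α} {R Q : Finset (Finset α)}
    (h1 : FeasOn s U R) (h2 : FeasOn s V Q) (hd : Disjoint U V) :
    FeasOn s (U ∪ V) (R ∪ Q) := by
  have hd' := Finset.disjoint_left.1 hd
  refine ⟨?_, ?_⟩
  · intro C hC
    rcases Finset.mem_union.1 hC with h | h
    · obtain ⟨a, b, c⟩ := h1.1 C h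
      exact ⟨a, b.trans Finset.subset_union_left, c⟩
    · obtain ⟨a, b, c⟩ := h2.1 C h
      exact ⟨a, b.trans Finset.subset_union_right, c⟩
  · intro i hi
    rcases Finset.mem_union.1 hi with h | h
    · obtain ⟨C, ⟨hC, hiC⟩, hu⟩ := h1.2 i h
      refine ⟨C, ⟨Finset.mem_union_left _ hC, hiC⟩, ?_⟩
      rintro D ⟨hD, hiD⟩
      rcases Finset.mem_union.1 hD with h' | h'
      · exact hu D ⟨h', hiD⟩
      · exact absurd ((h2.1 D h').2.1 hiD) (hd' h)
    · obtain ⟨C, ⟨hC, hiC⟩, hu⟩ := h2.2 i h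
      refine ⟨C, ⟨Finset.mem_union_right _ hC, hiC⟩, ?_⟩
      rintro D ⟨hD, hiD⟩
      rcases Finset.mem_union.1 hD with h' | h'
      · exact absurd h (hd' ((h1.1 D h').2.1 hiD))
      · exact hu D ⟨h', hiD⟩

lemma PairsOn.glue {U V : Finset α} {R Q : Finset (Finset α)}
    (h1 : PairsOn s U R) (h2 : PairsOn s V Q) (hd : Disjoint U V) :
    PairsOn s (U ∪ V) (R ∪ Q) := by
  refine ⟨h1.1.glue h2.1 hd, ?_, ?_⟩
  · intro C hC
    rcases Finset.mem_union.1 hC with h | h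
    · exact h1.2.1 C h
    · exact h2.2.1 C h
  · rw [Finset.card_union_of_disjoint (h1.1.disj h2.1 hd), Finset.card_union_of_disjoint hd,
      ← h1.2.2, ← h2.2.2]
    ring

lemma FeasOn.remove {U A : Finset α} {P : Finset (Finset α)}
    (h : FeasOn s U P) (hA : A ∈ P) : FeasOn s (U \ A) (P.erase A) := by
  refine ⟨?_, ?_⟩
  · intro C hC
    obtain ⟨hne, hC⟩ := Finset.mem_erase.1 hC
    obtain ⟨a, b, c⟩ := h.1 C hC
    refine ⟨a, ?_, c⟩
    intro i hi
    refine Finset.mem_sdiff.2 ⟨b hi, fun hiA => hne ?_⟩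
    exact (h.2 i (b hi)).unique ⟨hC, hi⟩ ⟨hA, hiA⟩
  · intro i hi
    obtain ⟨hiU, hiA⟩ := Finset.mem_sdiff.1 hi
    obtain ⟨C, ⟨hC, hiC⟩, hu⟩ := h.2 i hiU
    refine ⟨C, ⟨Finset.mem_erase.2 ⟨?_, hC⟩, hiC⟩, ?_⟩
    · rintro rfl; exact hiA hiC
    · rintro D ⟨hD, hiD⟩
      exact hu D ⟨Finset.mem_of_mem_erase hD, hiD⟩

lemma pairsOn_pair {x y : α} (hxy : x ≠ y) (h : s x + s y ≤ 1) :
    PairsOn s {x, y} {{x, y}} := by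
  refine ⟨⟨?_, ?_⟩, ?_, ?_⟩
  · intro C hC
    rw [Finset.mem_singleton] at hC
    subst hC
    exact ⟨⟨x, by simp⟩, subset_rfl, by rwa [Finset.sum_pair hxy]⟩
  · intro i hi
    exact ⟨{x, y}, ⟨by simp, hi⟩, fun D hD => by simpa using hD.1⟩
  · intro C hC
    rw [Finset.mem_singleton] at hC
    subst hC
    exact Finset.card_pair hxy
  · rw [Finset.card_pair hxy]; simp

lemma exists_pairs (hs : ∀ i, 0 ≤ s i) (m : ℕ) : ∀ B : Finset α, B.card = 2 * m →
    ∑ i ∈ B, s i ≤ 1 → ∃ R, PairsOn s B R := by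
  induction m with
  | zero =>
    intro B hB _
    have : B = ∅ := by simpa using hB
    subst this
    exact ⟨∅, ⟨by simp, by simp⟩, by simp, by simp⟩
  | succ m ih =>
    intro B hB hsum
    obtain ⟨x, hx, y, hy, hxy⟩ := Finset.one_lt_card.1 (show 1 < B.card by omega)
    have hsub : ({x, y} : Finset α) ⊆ B := by
      intro z hz
      rcases Finset.mem_insert.1 hz with rfl | hz
      · exact hx
      · rw [Finset.mem_singleton.1 hz]; exact hy
    have hle : ∀ C ⊆ B, ∑ i ∈ C, s i ≤ 1 := fun C hC =>
      (Finset.sum_le_sum_of_subset_of_nonneg hC (fun i _ _ => hs i)).trans hsum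
    obtain ⟨R, hR⟩ := ih (B \ {x, y})
      (by rw [Finset.card_sdiff_of_subset hsub, Finset.card_pair hxy]; omega)
      (hle _ Finset.sdiff_subset)
    have h2 := hle _ hsub
    rw [Finset.sum_pair hxy] at h2
    refine ⟨R ∪ {{x, y}}, ?_⟩
    have := hR.glue (pairsOn_pair hxy h2) Finset.sdiff_disjoint
    rwa [Finset.sdiff_union_of_subset hsub] at this

lemma exists_small {A : Finset α} (hA : 3 ≤ A.card) (h : ∑ i ∈ A, s i ≤ 1) :
    ∃ x ∈ A, s x ≤ 1 / 2 := by
  by_contra! hc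
  have h1 : ∑ i ∈ A, (1 / 2 : ℚ) ≤ ∑ i ∈ A, s i := Finset.sum_le_sum fun i hi => (hc i hi).le
  rw [Finset.sum_const, nsmul_eq_mul] at h1
  have : (3 : ℚ) ≤ A.card := by exact_mod_cast hA
  linarith

lemma exists_pairs_two (hs : ∀ i, 0 ≤ s i) {A B : Finset α} (hd : Disjoint A B)
    (hA : 3 ≤ A.card) (hB : 3 ≤ B.card) (oA : Odd A.card) (oB : Odd B.card)
    (sA : ∑ i ∈ A, s i ≤ 1) (sB : ∑ i ∈ B, s i ≤ 1) : ∃ R, PairsOn s (A ∪ B) R := by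
  obtain ⟨x, hx, hx2⟩ := exists_small hA sA
  obtain ⟨y, hy, hy2⟩ := exists_small hB sB
  have hd' := Finset.disjoint_left.1 hd
  have hxy : x ≠ y := by rintro rfl; exact hd' hx hy
  have key : ∀ (D : Finset α) (z : α), z ∈ D → Odd D.card → ∑ i ∈ D, s i ≤ 1 →
      ∃ R, PairsOn s (D.erase z) R := by
    intro D z hz ⟨k, hk⟩ hD
    refine exists_pairs hs k _ (by rw [Finset.card_erase_of_mem hz]; omega) ?_
    exact (Finset.sum_le_sum_of_subset_of_nonneg (Finset.erase_subset _ _)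
      (fun i _ _ => hs i)).trans hD
  obtain ⟨R, hR⟩ := key A x hx oA sA
  obtain ⟨Q, hQ⟩ := key B y hy oB sB
  have h1 := hR.glue hQ (hd.mono (Finset.erase_subset _ _) (Finset.erase_subset _ _))
  have h2 := h1.glue (pairsOn_pair (s := s) hxy (by linarith)) (by
    rw [Finset.disjoint_left]
    intro z hz hz'
    simp only [Finset.mem_union, Finset.mem_erase, Finset.mem_insert, Finset.mem_singleton] at hz hz'
    rcases hz' with rfl | rfl
    · rcases hz with h | h
      · exact h.1 rfl
      · exact hd' hx h.2
    · rcases hz with h | h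
      · exact hd' h.2 hy
      · exact h.1 rfl)
  refine ⟨R ∪ Q ∪ {{x, y}}, ?_⟩
  · convert h2 using 1
    ext z
    simp only [Finset.mem_union, Finset.mem_erase, Finset.mem_insert, Finset.mem_singleton]
    by_cases h3 : z = x
    · subst h3; simp [hx]
    · by_cases h4 : z = y
      · subst h4; simp [hy]
      · simp [h3, h4]

/-- Number of bins of cardinality at least three. -/
def bigs (P : Finset (Finset α)) : ℕ := (P.filter fun B => 3 ≤ B.card).card

lemma replace_pairs (f : ℕ → ℚ) {U V : Finset α} {P R : Finset (Finset α)}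
    (hP : FeasOn s V P) (hR : PairsOn s U R) (hd : Disjoint V U) :
    FeasOn s (V ∪ U) (P ∪ R) ∧
      ∑ B ∈ P ∪ R, f B.card = ∑ B ∈ P, f B.card + U.card * (f 2 / 2) ∧
      bigs (P ∪ R) = bigs P := by
  refine ⟨hP.glue hR.1 hd, ?_, ?_⟩
  · rw [Finset.sum_union (hP.disj hR.1 hd)]
    congr 1
    rw [Finset.sum_congr rfl (fun B hB => by rw [hR.2.1 B hB]), Finset.sum_const, ← hR.2.2]
    push_cast
    rw [nsmul_eq_mul]
    ring
  · unfold bigs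
    rw [Finset.filter_union, Finset.filter_false_of_mem (s := R), Finset.union_empty]
    intro B hB
    rw [hR.2.1 B hB]
    norm_num

lemma bigs_erase {P : Finset (Finset α)} {A : Finset α} (hA : A ∈ P) (h : 3 ≤ A.card) :
    bigs (P.erase A) < bigs P := by
  unfold bigs
  rw [Finset.filter_erase]
  exact Finset.card_erase_lt_of_mem (Finset.mem_filter.2 ⟨hA, h⟩)

end aux

/-- If `f j / j ≥ f 2 / 2` for every `j ∈ {1,…,n}` (with `n ≥ 2`), then some
minimum-cost feasible solution of the GCBP instance has at most one bin of cardinality at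
least 3, that bin (if any) has odd cardinality, and every other bin has cardinality 1 or 2. -/
theorem optimal_structure_k_eq_two (n : ℕ) (hn : 2 ≤ n) (s : Fin n → ℚ) (f : ℕ → ℚ)
    (hs : ∀ i, 0 ≤ s i ∧ s i ≤ 1)
    (hf0 : f 0 = 0)
    (hfnonneg : ∀ j, j ≤ n → 0 ≤ f j)
    (hfmono : ∀ j j', j ≤ j' → j' ≤ n → f j ≤ f j')
    (hk : ∀ j, 1 ≤ j → j ≤ n → f 2 / 2 ≤ f j / (j : ℚ)) :
    ∃ P : Finset (Finset (Fin n)),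
      -- P is a feasible solution
      ((∀ B ∈ P, B.Nonempty) ∧ (∀ i : Fin n, ∃! B, B ∈ P ∧ i ∈ B) ∧
        (∀ B ∈ P, ∑ i ∈ B, s i ≤ 1)) ∧
      -- P has minimum cost among all feasible solutions
      (∀ Q : Finset (Finset (Fin n)),
        ((∀ B ∈ Q, B.Nonempty) ∧ (∀ i : Fin n, ∃! B, B ∈ Q ∧ i ∈ B) ∧
          (∀ B ∈ Q, ∑ i ∈ B, s i ≤ 1)) →
        ∑ B ∈ P, f B.card ≤ ∑ B ∈ Q, f B.card) ∧
      -- at most one bin has cardinality at least 3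
      (∀ B ∈ P, ∀ B' ∈ P, 3 ≤ B.card → 3 ≤ B'.card → B = B') ∧
      -- such a bin has odd cardinality
      (∀ B ∈ P, 3 ≤ B.card → Odd B.card) ∧
      -- every other bin has cardinality 1 or 2
      (∀ B ∈ P, B.card < 3 → B.card = 1 ∨ B.card = 2) := by
  classical
  have hs0 : ∀ i, 0 ≤ s i := fun i => (hs i).1
  have hiff : ∀ Q : Finset (Finset (Fin n)),
      ((∀ B ∈ Q, B.Nonempty) ∧ (∀ i : Fin n, ∃! B, B ∈ Q ∧ i ∈ B) ∧
        (∀ B ∈ Q, ∑ i ∈ B, s i ≤ 1)) ↔ FeasOn s Finset.univ Q := by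
    intro Q
    constructor
    · rintro ⟨a, b, c⟩
      exact ⟨fun C hC => ⟨a C hC, Finset.subset_univ _, c C hC⟩, fun i _ => b i⟩
    · rintro ⟨a, b⟩
      exact ⟨fun B hB => (a B hB).1, fun i => b i (Finset.mem_univ i), fun B hB => (a B hB).2.2⟩
  have hcost : ∀ B : Finset (Fin n), B.Nonempty → B.card * (f 2 / 2) ≤ f B.card := by
    intro B hB
    have h1 : 1 ≤ B.card := hB.card_pos
    have h2 : B.card ≤ n := by simpa using Finset.card_le_univ B
    have h3 := hk _ h1 h2
    have h4 : (0 : ℚ) < B.card := by exact_mod_cast h1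
    rw [le_div_iff₀ h4] at h3
    linarith
  let F : Finset (Finset (Finset (Fin n))) := Finset.univ.filter (FeasOn s Finset.univ)
  have hF : F.Nonempty := by
    refine ⟨Finset.univ.image (fun i => {i}), Finset.mem_filter.2 ⟨Finset.mem_univ _, ?_, ?_⟩⟩
    · intro C hC
      obtain ⟨i, _, rfl⟩ := Finset.mem_image.1 hC
      exact ⟨⟨i, by simp⟩, Finset.subset_univ _, by simpa using (hs i).2⟩
    · intro i _
      refine ⟨{i}, ⟨by simp, by simp⟩, ?_⟩
      rintro D ⟨hD, hiD⟩
      obtain ⟨j, _, rfl⟩ := Finset.mem_image.1 hD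
      rw [Finset.mem_singleton.1 hiD]
  obtain ⟨P₀, hP₀, hmin₀⟩ := F.exists_min_image (fun Q => ∑ B ∈ Q, f B.card) hF
  obtain ⟨P, hP, hmin⟩ := (F.filter fun Q => ∑ B ∈ Q, f B.card ≤ ∑ B ∈ P₀, f B.card).exists_min_image
    bigs ⟨P₀, Finset.mem_filter.2 ⟨hP₀, le_rfl⟩⟩
  obtain ⟨hPF, hPc⟩ := Finset.mem_filter.1 hP
  have hPf : FeasOn s Finset.univ P := (Finset.mem_filter.1 hPF).2
  have hno : ∀ Q, FeasOn s Finset.univ Q → ∑ B ∈ Q, f B.card ≤ ∑ B ∈ P, f B.card →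
      ¬ bigs Q < bigs P := by
    intro Q hQ hc
    exact not_lt.2 (hmin Q (Finset.mem_filter.2
      ⟨Finset.mem_filter.2 ⟨Finset.mem_univ _, hQ⟩, hc.trans hPc⟩))
  have hodd : ∀ B ∈ P, 3 ≤ B.card → Odd B.card := by
    intro B hB h3
    by_contra hodd
    obtain ⟨m, hm⟩ := Nat.not_odd_iff_even.1 hodd
    obtain ⟨R, hR⟩ := exists_pairs hs0 m B (by omega) (hPf.1 B hB).2.2
    obtain ⟨h1, h2, h4⟩ := replace_pairs f (hPf.remove hB) hR Finset.sdiff_disjoint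
    rw [Finset.sdiff_union_of_subset (Finset.subset_univ _)] at h1
    refine hno _ h1 ?_ (h4 ▸ bigs_erase hB h3)
    rw [h2, ← Finset.sum_erase_add P _ hB]
    have := hcost B (hPf.1 B hB).1
    linarith
  refine ⟨P, (hiff P).2 hPf, ?_, ?_, hodd, ?_⟩
  · intro Q hQ
    exact hPc.trans (hmin₀ Q (Finset.mem_filter.2 ⟨Finset.mem_univ _, (hiff Q).1 hQ⟩))
  · intro A hA B hB hA3 hB3
    by_contra hne
    have hd : Disjoint A B := by
      rw [Finset.disjoint_left]
      intro i hiA hiB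
      exact hne ((hPf.2 i (Finset.mem_univ i)).unique ⟨hA, hiA⟩ ⟨hB, hiB⟩)
    obtain ⟨R, hR⟩ := exists_pairs_two hs0 hd hA3 hB3 (hodd A hA hA3) (hodd B hB hB3)
      (hPf.1 A hA).2.2 (hPf.1 B hB).2.2
    have hB' : B ∈ P.erase A := Finset.mem_erase.2 ⟨fun h => hne h.symm, hB⟩
    have hrem := (hPf.remove hA).remove hB'
    rw [sdiff_sdiff_left, Finset.sup_eq_union] at hrem
    obtain ⟨h1, h2, h4⟩ := replace_pairs f hrem hR Finset.sdiff_disjoint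
    rw [Finset.sdiff_union_of_subset (Finset.subset_univ _)] at h1
    refine hno _ h1 ?_ (h4 ▸ (bigs_erase hB' hB3).trans (bigs_erase hA hA3))
    rw [h2, ← Finset.sum_erase_add P _ hA, ← Finset.sum_erase_add (P.erase A) _ hB',
      Finset.card_union_of_disjoint hd]
    have := hcost A (hPf.1 A hA).1
    have := hcost B (hPf.1 B hB).1
    push_cast
    linarith
  · intro B hB h3
    have := (hPf.1 B hB).1.card_pos
    omega
end

section
/- Let k ≥ 3 and m ≥ 1 be integers, let Z be a positive integer, and let s_1,…,s_{3m} be positive integers with Z/4 < s_i < Z/2 for every i and with s_1 + ⋯ + s_{3m} = mZ. Consider the GCBP instance whose item set consists of the 3m items of size s_i/Z together with m(k−3) additional items of size 0, with a monotone non-decreasing cost function f : {0,1,…,mk} → ℚ≥0 with f(0) = 0. If the index set {1,…,3m} can be partitioned into m triples each of total s-value exactly Z, then this GCBP instance admits a feasible solution of cost exactly m·f(k), namely m bins each containing the three items of one triple together with k−3 zero-size items. -/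
open Finset

/-- (3-Partition reduction, YES direction.) Given a YES instance of
3-Partition, the associated GCBP instance — the `3m` items of size `s i / Z` together with
`m·(k−3)` zero-size items — admits a feasible solution consisting of `m` bins, each of
cardinality `k`, of total cost exactly `m · f k`. -/
theorem three_partition_yes_gives_cheap_packing
    (k m Z : ℕ) (hk : 3 ≤ k) (hm : 1 ≤ m) (hZ : 0 < Z)
    (s : Fin (3 * m) → ℕ) (hspos : ∀ i, 0 < s i)
    (hlow : ∀ i, Z < 4 * s i) (hhigh : ∀ i, 2 * s i < Z)
    (hsum : ∑ i, s i = m * Z)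
    (f : ℕ → ℚ) (hf0 : f 0 = 0)
    (hfnonneg : ∀ j, j ≤ m * k → 0 ≤ f j)
    (hfmono : ∀ j j', j ≤ j' → j' ≤ m * k → f j ≤ f j')
    -- YES instance: a partition of the indices into m triples each of total s-value Z
    (t : Fin (3 * m) → Fin m)
    (htcard : ∀ j : Fin m, (univ.filter fun i => t i = j).card = 3)
    (htsum : ∀ j : Fin m, ∑ i ∈ univ.filter (fun i => t i = j), s i = Z) :
    ∃ P : Finset (Finset (Fin (3 * m) ⊕ Fin (m * (k - 3)))),
      -- P is a feasible solution of the GCBP instance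
      ((∀ B ∈ P, B.Nonempty) ∧
        (∀ x : Fin (3 * m) ⊕ Fin (m * (k - 3)), ∃! B, B ∈ P ∧ x ∈ B) ∧
        (∀ B ∈ P,
          ∑ x ∈ B, Sum.elim (fun i => (s i : ℚ) / (Z : ℚ)) (fun _ => 0) x ≤ 1)) ∧
      -- consisting of m bins, each with k items
      P.card = m ∧ (∀ B ∈ P, B.card = k) ∧
      -- of total cost exactly m · f k
      ∑ B ∈ P, f B.card = (m : ℚ) * f k := by
  obtain ⟨u, hu⟩ : ∃ u : Fin (m * (k - 3)) → Fin m,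
      ∀ j, (univ.filter fun i => u i = j).card = k - 3 := by
    refine ⟨fun z => (finProdFinEquiv.symm z).1, fun j => ?_⟩
    have h : (univ.filter fun z : Fin (m * (k - 3)) => (finProdFinEquiv.symm z).1 = j)
        = univ.image (fun a : Fin (k - 3) => finProdFinEquiv (j, a)) := by
      ext z
      simp only [mem_filter, mem_univ, true_and, mem_image]
      constructor
      · intro hz
        refine ⟨(finProdFinEquiv.symm z).2, ?_⟩
        rw [← hz]
        exact finProdFinEquiv.apply_symm_apply z
      · rintro ⟨a, rfl⟩
        rw [Equiv.symm_apply_apply]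
    rw [h, card_image_of_injective, card_univ, Fintype.card_fin]
    intro a b hab
    have := finProdFinEquiv.injective hab
    exact (Prod.mk.inj this).2
  let b : Fin m → Finset (Fin (3 * m) ⊕ Fin (m * (k - 3))) := fun j =>
    (univ.filter fun i => t i = j).disjSum (univ.filter fun i => u i = j)
  have hmem : ∀ j x, x ∈ b j ↔ Sum.elim t u x = j := by
    intro j x
    cases x <;> simp [b]
  have hcard : ∀ j, (b j).card = k := by
    intro j
    simp only [b, card_disjSum, htcard, hu]
    omega
  have hne : ∀ j, (b j).Nonempty := by
    intro j
    rw [← card_pos, hcard]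
    omega
  have hinj : Function.Injective b := by
    intro i j hij
    obtain ⟨x, hx⟩ := hne i
    have h1 := (hmem i x).1 hx
    rw [hij] at hx
    exact h1.symm.trans ((hmem j x).1 hx)
  have hP : (univ.image b).card = m := by
    rw [card_image_of_injective _ hinj, card_univ, Fintype.card_fin]
  have hk' : ∀ B ∈ univ.image b, B.card = k := by
    intro B hB
    obtain ⟨j, -, rfl⟩ := mem_image.1 hB
    exact hcard j
  refine ⟨univ.image b, ⟨?_, ?_, ?_⟩, hP, hk', ?_⟩
  · intro B hB
    obtain ⟨j, -, rfl⟩ := mem_image.1 hB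
    exact hne j
  · intro x
    refine ⟨b (Sum.elim t u x), ⟨mem_image_of_mem _ (mem_univ _), (hmem _ x).2 rfl⟩, ?_⟩
    rintro B ⟨hB, hx⟩
    obtain ⟨j, -, rfl⟩ := mem_image.1 hB
    rw [(hmem j x).1 hx]
  · intro B hB
    obtain ⟨j, -, rfl⟩ := mem_image.1 hB
    have hZ' : (Z : ℚ) ≠ 0 := by positivity
    simp only [b, sum_disjSum, Sum.elim_inl, Sum.elim_inr, sum_const_zero, add_zero]
    rw [← sum_div, ← Nat.cast_sum, htsum, div_self hZ']
  · rw [sum_congr rfl (fun B hB => by rw [hk' B hB]), sum_const, hP, nsmul_eq_mul]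
end

section
/- Let k ≥ 3 and m ≥ 1 be integers, let Z be a positive integer, and let s_1,…,s_{3m} be positive integers with Z/4 < s_i < Z/2 for every i and with s_1 + ⋯ + s_{3m} = mZ. Consider the GCBP instance whose item set consists of the 3m items of size s_i/Z together with m(k−3) additional items of size 0, with a monotone non-decreasing cost function f : {0,1,…,mk} → ℚ≥0 with f(0) = 0, and assume f(i)/i > f(k)/k for every i with 1 ≤ i < k and f(i)/i ≥ f(k)/k for every i with k ≤ i ≤ mk. If there is no partition of the index set {1,…,3m} into m triples each of total s-value exactly Z, then every feasible solution of this GCBP instance has cost strictly greater than m·f(k). -/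
open Finset

/-- (3-Partition reduction, NO direction.) If the 3-Partition instance has no
partition into `m` triples of total value `Z`, and `f(i)/i > f(k)/k` for `1 ≤ i < k` while
`f(i)/i ≥ f(k)/k` for `k ≤ i ≤ mk`, then every feasible solution of the associated GCBP
instance has cost strictly greater than `m · f k`. -/
theorem three_partition_no_forces_expensive_packing
    (k m Z : ℕ) (hk : 3 ≤ k) (hm : 1 ≤ m) (hZ : 0 < Z)
    (s : Fin (3 * m) → ℕ) (hspos : ∀ i, 0 < s i)
    (hlow : ∀ i, Z < 4 * s i) (hhigh : ∀ i, 2 * s i < Z)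
    (hsum : ∑ i, s i = m * Z)
    (f : ℕ → ℚ) (hf0 : f 0 = 0)
    (hfnonneg : ∀ j, j ≤ m * k → 0 ≤ f j)
    (hfmono : ∀ j j', j ≤ j' → j' ≤ m * k → f j ≤ f j')
    (hstrict : ∀ i, 1 ≤ i → i < k → f k / (k : ℚ) < f i / (i : ℚ))
    (hge : ∀ i, k ≤ i → i ≤ m * k → f k / (k : ℚ) ≤ f i / (i : ℚ))
    -- NO instance: no partition of the indices into m triples each of total s-value Z
    (hno : ¬ ∃ t : Fin (3 * m) → Fin m,
      (∀ j : Fin m, (univ.filter fun i => t i = j).card = 3) ∧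
      (∀ j : Fin m, ∑ i ∈ univ.filter (fun i => t i = j), s i = Z)) :
    ∀ P : Finset (Finset (Fin (3 * m) ⊕ Fin (m * (k - 3)))),
      ((∀ B ∈ P, B.Nonempty) ∧
        (∀ x : Fin (3 * m) ⊕ Fin (m * (k - 3)), ∃! B, B ∈ P ∧ x ∈ B) ∧
        (∀ B ∈ P,
          ∑ x ∈ B, Sum.elim (fun i => (s i : ℚ) / (Z : ℚ)) (fun _ => 0) x ≤ 1)) →
      (m : ℚ) * f k < ∑ B ∈ P, f B.card := by
  classical
  rintro P ⟨hne, hP, hcap⟩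
  have key : ∀ {M : Type} [AddCommMonoid M] (h : Fin (3 * m) ⊕ Fin (m * (k - 3)) → M),
      ∑ B ∈ P, ∑ x ∈ B, h x = ∑ x, h x := by
    intro M _ h
    have hd : Set.PairwiseDisjoint (P : Set (Finset (Fin (3 * m) ⊕ Fin (m * (k - 3))))) id := by
      intro B hB C hC hne
      refine Finset.disjoint_left.2 fun x hx hx' => hne ?_
      exact (hP x).unique ⟨hB, hx⟩ ⟨hC, hx'⟩
    have hu : P.biUnion id = univ := by
      ext x
      obtain ⟨B, hB, -⟩ := hP x
      simpa using ⟨B, hB⟩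
    rw [← hu, Finset.sum_biUnion hd]
    rfl
  have hL : ∀ {M : Type} [AddCommMonoid M] (u : Fin (3 * m) → M)
      (B : Finset (Fin (3 * m) ⊕ Fin (m * (k - 3)))),
      ∑ x ∈ B, Sum.elim u (fun _ => 0) x = ∑ i ∈ univ.filter (fun i => Sum.inl i ∈ B), u i := by
    intro M _ u B
    have h : ∑ x ∈ B, Sum.elim u (fun _ => 0) x
        = ∑ x, if x ∈ B then Sum.elim u (fun _ => 0) x else 0 := by
      rw [← Finset.sum_filter]
      simp
    rw [h, Finset.sum_filter, Fintype.sum_sum_type]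
    simp
  have hcard : ∑ B ∈ P, B.card = m * k := by
    have h := key (fun _ => (1 : ℕ))
    simp only [Finset.sum_const, smul_eq_mul, mul_one, Finset.card_univ, Fintype.card_sum,
      Fintype.card_fin] at h
    rw [h]
    obtain ⟨r, rfl⟩ := Nat.exists_eq_add_of_le hk
    rw [Nat.add_sub_cancel_left]
    ring
  have hk0 : (0 : ℚ) < k := by exact_mod_cast (by omega : 0 < k)
  have hle : ∀ B ∈ P, (B.card : ℚ) * (f k / k) ≤ f B.card := by
    intro B hB
    rcases Nat.eq_zero_or_pos B.card with h0 | h0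
    · simp [h0, hf0]
    have hmk : B.card ≤ m * k := hcard ▸ Finset.single_le_sum (f := fun B => B.card)
      (fun _ _ => Nat.zero_le _) hB
    have h1 : (0 : ℚ) < B.card := by exact_mod_cast h0
    have : f k / (k : ℚ) ≤ f B.card / (B.card : ℚ) := by
      rcases lt_or_ge B.card k with h | h
      · exact (hstrict _ h0 h).le
      · exact hge _ h hmk
    rw [le_div_iff₀ h1] at this
    linarith
  have htot : ∑ B ∈ P, (B.card : ℚ) * (f k / k) = m * f k := by
    rw [← Finset.sum_mul, ← Nat.cast_sum, hcard]
    push_cast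
    field_simp
  by_contra hcon
  rw [not_lt, ← htot] at hcon
  have heq := (Finset.sum_eq_sum_iff_of_le hle).1 (le_antisymm (Finset.sum_le_sum hle) hcon)
  have hbig : ∀ B ∈ P, k ≤ B.card := by
    intro B hB
    by_contra hlt
    rw [not_le] at hlt
    have h0 : 0 < B.card := Finset.card_pos.2 (hne B hB)
    have h1 : (0 : ℚ) < B.card := by exact_mod_cast h0
    have h2 := hstrict _ h0 hlt
    rw [lt_div_iff₀ h1] at h2
    have := heq B hB
    linarith
  have hPm : P.card ≤ m := by
    have h : P.card * k ≤ m * k := by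
      rw [← hcard, ← smul_eq_mul]
      exact Finset.card_nsmul_le_sum _ _ _ hbig
    exact Nat.le_of_mul_le_mul_right h (by omega)
  have hZq : (0 : ℚ) < Z := by exact_mod_cast hZ
  have hcap' : ∀ B ∈ P, ∑ i ∈ univ.filter (fun i => Sum.inl i ∈ B), s i ≤ Z := by
    intro B hB
    have h := hcap B hB
    rw [hL, ← Finset.sum_div, div_le_one hZq] at h
    exact_mod_cast h
  have hsz : ∑ B ∈ P, ∑ i ∈ univ.filter (fun i => Sum.inl i ∈ B), s i = m * Z := by
    rw [← hsum]
    have h := key (Sum.elim s (fun _ => 0))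
    simp only [hL] at h
    rw [h]
    simp
  have hsz' : m * Z ≤ P.card * Z := by
    rw [← hsz]
    exact Finset.sum_le_card_nsmul _ _ _ hcap'
  have hPeq : P.card = m := le_antisymm hPm (Nat.le_of_mul_le_mul_right hsz' hZ)
  have hexact : ∀ B ∈ P, ∑ i ∈ univ.filter (fun i => Sum.inl i ∈ B), s i = Z := by
    refine (Finset.sum_eq_sum_iff_of_le hcap').1 ?_
    rw [hsz, Finset.sum_const, hPeq, smul_eq_mul]
  have hthree : ∀ B ∈ P, (univ.filter (fun i : Fin (3 * m) => Sum.inl i ∈ B)).card = 3 := by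
    intro B hB
    have h := hexact B hB
    set L := univ.filter (fun i : Fin (3 * m) => Sum.inl i ∈ B)
    have h1 : L.card * (Z + 1) ≤ 4 * Z := by
      rw [← h, Finset.mul_sum, ← smul_eq_mul, h]
      exact Finset.card_nsmul_le_sum _ _ _ fun i _ => hlow i
    have h2 : 2 * Z + L.card ≤ L.card * Z := by
      have : ∑ i ∈ L, (2 * s i + 1) ≤ L.card • Z :=
        Finset.sum_le_card_nsmul _ _ _ fun i _ => hhigh i
      rw [Finset.sum_add_distrib, ← Finset.mul_sum, h] at this
      simpa using this
    have h3 : L.card < 4 := by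
      by_contra hh
      nlinarith
    have h4 : 2 < L.card := by
      by_contra hh
      have : L.card * Z ≤ 2 * Z := Nat.mul_le_mul_right _ (by omega)
      have h0 : L.card = 0 := by omega
      simp [h0] at h2
      omega
    omega
  choose b hb hbu using hP
  let e : P ≃ Fin m := P.equivFinOfCardEq hPeq
  have hfib : ∀ j : Fin m, (univ.filter fun i => e ⟨b (Sum.inl i), (hb _).1⟩ = j)
      = univ.filter (fun i : Fin (3 * m) => Sum.inl i ∈ (e.symm j).1) := by
    intro j
    ext i
    simp only [Finset.mem_filter, Finset.mem_univ, true_and]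
    constructor
    · rintro rfl
      simpa using (hb (Sum.inl i)).2
    · intro h
      rw [← Equiv.eq_symm_apply]
      exact Subtype.ext (hbu _ _ ⟨(e.symm j).2, h⟩).symm
  refine hno ⟨fun i => e ⟨b (Sum.inl i), (hb _).1⟩, fun j => ?_, fun j => ?_⟩
  · rw [hfib]
    exact hthree _ (e.symm j).2
  · rw [hfib]
    exact hexact _ (e.symm j).2
end

section
/- Let S, A, B be pairwise disjoint finite sets of items with nonnegative rational sizes, and suppose there is an injection g : A → B such that the size of a is at most the size of g(a) for every a ∈ A. Let a partition of B ∪ S into bins each of total size at most 1 be given, and let f be any monotone non-decreasing cost function on cardinalities with f(0) = 0. Then there exists a partition of A ∪ S into bins each of total size at most 1 whose cost (the sum over bins B' of f(|B'|)) is at most the cost of the given partition of B ∪ S; in particular the minimum cost of a feasible packing of A ∪ S is at most the cost of any feasible packing of B ∪ S. -/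
open Finset

/-- (Substitution lemma.) Let `S, A, B` be pairwise disjoint finite sets of
items with nonnegative sizes and let `g` map `A` injectively into `B` with
`s a ≤ s (g a)`. Then from any feasible packing of `B ∪ S` one obtains a feasible packing
of `A ∪ S` of no larger cost. -/
theorem substitution_lemma {ι : Type*} [DecidableEq ι]
    (s : ι → ℚ) (hs : ∀ i, 0 ≤ s i)
    (S A B : Finset ι)
    (hSA : Disjoint S A) (hSB : Disjoint S B) (hAB : Disjoint A B)
    (g : ι → ι)
    (hgmem : ∀ a ∈ A, g a ∈ B)
    (hginj : ∀ a ∈ A, ∀ a' ∈ A, g a = g a' → a = a')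
    (hgsize : ∀ a ∈ A, s a ≤ s (g a))
    (f : ℕ → ℚ) (hf0 : f 0 = 0) (hfmono : Monotone f)
    (P : Finset (Finset ι))
    (hPne : ∀ b ∈ P, b.Nonempty)
    (hPsub : ∀ b ∈ P, b ⊆ B ∪ S)
    (hPcover : ∀ x ∈ B ∪ S, ∃! b, b ∈ P ∧ x ∈ b)
    (hPfeas : ∀ b ∈ P, ∑ i ∈ b, s i ≤ 1) :
    ∃ Q : Finset (Finset ι),
      (∀ b ∈ Q, b.Nonempty) ∧
      (∀ b ∈ Q, b ⊆ A ∪ S) ∧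
      (∀ x ∈ A ∪ S, ∃! b, b ∈ Q ∧ x ∈ b) ∧
      (∀ b ∈ Q, ∑ i ∈ b, s i ≤ 1) ∧
      ∑ b ∈ Q, f b.card ≤ ∑ b ∈ P, f b.card := by
  classical
  obtain ⟨h, hh⟩ : ∃ h : ι → ι, h = fun x => if x ∈ A then g x else x := ⟨_, rfl⟩
  have hA : ∀ x ∈ A, h x = g x := by intro x hx; simp [hh, hx]
  have hS : ∀ x ∈ S, h x = x := by
    intro x hx
    have : x ∉ A := Finset.disjoint_left.mp hSA hx
    simp [hh, this]
  have hmem : ∀ x ∈ A ∪ S, h x ∈ B ∪ S := by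
    intro x hx
    rcases Finset.mem_union.mp hx with hx | hx
    · rw [hA x hx]; exact Finset.mem_union_left _ (hgmem x hx)
    · rw [hS x hx]; exact Finset.mem_union_right _ hx
  have hinj : ∀ x ∈ A ∪ S, ∀ y ∈ A ∪ S, h x = h y → x = y := by
    intro x hx y hy hxy
    rcases Finset.mem_union.mp hx with hx | hx <;> rcases Finset.mem_union.mp hy with hy | hy
    · rw [hA x hx, hA y hy] at hxy; exact hginj x hx y hy hxy
    · rw [hA x hx, hS y hy] at hxy
      exact absurd (hxy ▸ hgmem x hx) (Finset.disjoint_left.mp hSB hy)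
    · rw [hS x hx, hA y hy] at hxy
      exact absurd (hxy ▸ hgmem y hy) (Finset.disjoint_left.mp hSB hx)
    · rwa [hS x hx, hS y hy] at hxy
  have hsize : ∀ x ∈ A ∪ S, s x ≤ s (h x) := by
    intro x hx
    rcases Finset.mem_union.mp hx with hx | hx
    · rw [hA x hx]; exact hgsize x hx
    · rw [hS x hx]
  obtain ⟨T, hT⟩ : ∃ T : Finset ι → Finset ι, ∀ b x, x ∈ T b ↔ x ∈ A ∪ S ∧ h x ∈ b :=
    ⟨fun b => (A ∪ S).filter (fun x => h x ∈ b), fun b x => Finset.mem_filter⟩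
  have hTinj : ∀ b, Set.InjOn h (T b : Set ι) := by
    intro b x hx y hy hxy
    exact hinj x ((hT b x).1 hx).1 y ((hT b y).1 hy).1 hxy
  have hcard : ∀ b, (T b).card ≤ b.card := fun b =>
    Finset.card_le_card_of_injOn h (fun x hx => ((hT b x).1 hx).2) (hTinj b)
  have hsum : ∀ b, ∑ i ∈ T b, s i ≤ ∑ i ∈ b, s i := by
    intro b
    calc ∑ i ∈ T b, s i ≤ ∑ i ∈ T b, s (h i) :=
          Finset.sum_le_sum fun i hi => hsize i ((hT b i).1 hi).1
      _ = ∑ j ∈ (T b).image h, s j := (Finset.sum_image (hTinj b)).symm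
      _ ≤ ∑ i ∈ b, s i := by
          refine Finset.sum_le_sum_of_subset_of_nonneg ?_ fun i _ _ => hs i
          intro j hj
          obtain ⟨x, hx, rfl⟩ := Finset.mem_image.mp hj
          exact ((hT b x).1 hx).2
  have huniq : ∀ b ∈ P, ∀ c ∈ P, ∀ x, x ∈ T b → x ∈ T c → b = c := by
    intro b hb c hc x hxb hxc
    have h1 := (hT b x).1 hxb
    have h2 := (hT c x).1 hxc
    exact (hPcover _ (hmem x h1.1)).unique ⟨hb, h1.2⟩ ⟨hc, h2.2⟩
  refine ⟨(P.filter fun b => (T b).Nonempty).image T, ?_, ?_, ?_, ?_, ?_⟩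
  · intro q hq
    obtain ⟨b, hb, rfl⟩ := Finset.mem_image.mp hq
    exact (Finset.mem_filter.mp hb).2
  · intro q hq x hx
    obtain ⟨b, hb, rfl⟩ := Finset.mem_image.mp hq
    exact ((hT b x).1 hx).1
  · intro x hx
    obtain ⟨b, ⟨hb, hxb⟩, -⟩ := hPcover _ (hmem x hx)
    have hxT : x ∈ T b := (hT b x).2 ⟨hx, hxb⟩
    refine ⟨T b, ⟨Finset.mem_image_of_mem _ (Finset.mem_filter.mpr ⟨hb, x, hxT⟩), hxT⟩, ?_⟩
    rintro q ⟨hq, hxq⟩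
    obtain ⟨c, hc, rfl⟩ := Finset.mem_image.mp hq
    rw [huniq c (Finset.mem_filter.mp hc).1 b hb x hxq hxT]
  · intro q hq
    obtain ⟨b, hb, rfl⟩ := Finset.mem_image.mp hq
    exact (hsum b).trans (hPfeas b (Finset.mem_filter.mp hb).1)
  · rw [Finset.sum_image]
    · calc ∑ b ∈ P.filter (fun b => (T b).Nonempty), f (T b).card
          ≤ ∑ b ∈ P.filter (fun b => (T b).Nonempty), f b.card :=
            Finset.sum_le_sum fun b _ => hfmono (hcard b)
        _ ≤ ∑ b ∈ P, f b.card := by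
            refine Finset.sum_le_sum_of_subset_of_nonneg (Finset.filter_subset _ _) ?_
            intro b _ _
            rw [← hf0]
            exact hfmono (Nat.zero_le _)
    · intro b hb c hc hbc
      obtain ⟨hbP, x, hx⟩ := Finset.mem_filter.mp hb
      exact huniq b hbP c (Finset.mem_filter.mp hc).1 x hx (hbc ▸ hx)
end

section
/- Let B and B' be two disjoint finite sets of items with nonnegative real sizes, each of total size at most 1, and suppose |B| and |B'| are both odd and at least 3. Then B ∪ B' can be partitioned into (|B|+|B'|)/2 pairs, each pair having total size at most 1. -/
open Finset

/-- `P` partitions `S` into feasible pairs. -/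
def IsPairing {ι : Type*} [DecidableEq ι] (s : ι → ℝ) (S : Finset ι)
    (P : Finset (Finset ι)) : Prop :=
  (∀ p ∈ P, p.card = 2 ∧ ∑ i ∈ p, s i ≤ 1) ∧
  (∀ p ∈ P, p ⊆ S) ∧
  (∀ x ∈ S, ∃! p, p ∈ P ∧ x ∈ p) ∧
  P.card * 2 = S.card

theorem IsPairing.union {ι : Type*} [DecidableEq ι] {s : ι → ℝ} {S T : Finset ι}
    {P Q : Finset (Finset ι)} (hP : IsPairing s S P) (hQ : IsPairing s T Q)
    (hd : Disjoint S T) : IsPairing s (S ∪ T) (P ∪ Q) := by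
  obtain ⟨p1, p2, p3, p4⟩ := hP
  obtain ⟨q1, q2, q3, q4⟩ := hQ
  have hd' := Finset.disjoint_left.mp hd
  refine ⟨?_, ?_, ?_, ?_⟩
  · intro p hp
    rcases Finset.mem_union.mp hp with h | h
    · exact p1 p h
    · exact q1 p h
  · intro p hp
    rcases Finset.mem_union.mp hp with h | h
    · exact (p2 p h).trans Finset.subset_union_left
    · exact (q2 p h).trans Finset.subset_union_right
  · intro x hx
    rcases Finset.mem_union.mp hx with h | h
    · obtain ⟨p, ⟨hp, hxp⟩, hu⟩ := p3 x h
      refine ⟨p, ⟨Finset.mem_union_left _ hp, hxp⟩, ?_⟩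
      rintro y ⟨hy, hxy⟩
      rcases Finset.mem_union.mp hy with h' | h'
      · exact hu y ⟨h', hxy⟩
      · exact absurd (q2 y h' hxy) (hd' h)
    · obtain ⟨p, ⟨hp, hxp⟩, hu⟩ := q3 x h
      refine ⟨p, ⟨Finset.mem_union_right _ hp, hxp⟩, ?_⟩
      rintro y ⟨hy, hxy⟩
      rcases Finset.mem_union.mp hy with h' | h'
      · exact absurd h (hd' (p2 y h' hxy))
      · exact hu y ⟨h', hxy⟩
  · have hPQ : Disjoint P Q := by
      rw [Finset.disjoint_left]
      intro p hp hq
      have hne : p.Nonempty := by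
        rw [← Finset.card_pos, (p1 p hp).1]; norm_num
      obtain ⟨x, hx⟩ := hne
      exact hd' (p2 p hp hx) (q2 p hq hx)
    rw [Finset.card_union_of_disjoint hPQ, Finset.card_union_of_disjoint hd]
    omega

theorem isPairing_single {ι : Type*} [DecidableEq ι] {s : ι → ℝ} {S : Finset ι}
    (hc : S.card = 2) (hS : ∑ i ∈ S, s i ≤ 1) : IsPairing s S {S} := by
  refine ⟨?_, ?_, ?_, ?_⟩
  · intro p hp
    rw [Finset.mem_singleton.mp hp]
    exact ⟨hc, hS⟩
  · intro p hp
    rw [Finset.mem_singleton.mp hp]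
  · intro x hx
    exact ⟨S, ⟨Finset.mem_singleton_self S, hx⟩, fun y hy => Finset.mem_singleton.mp hy.1⟩
  · simp [hc]

theorem exists_isPairing {ι : Type*} [DecidableEq ι] {s : ι → ℝ} (hs : ∀ i, 0 ≤ s i) (k : ℕ) :
    ∀ S : Finset ι, S.card = 2 * k → ∑ i ∈ S, s i ≤ 1 → ∃ P, IsPairing s S P := by
  induction k with
  | zero =>
    intro S hc _
    have : S = ∅ := Finset.card_eq_zero.mp (by omega)
    subst this
    exact ⟨∅, by simp [IsPairing]⟩
  | succ k ih =>
    intro S hc hS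
    obtain ⟨T, hT, hTc⟩ := Finset.exists_subset_card_eq (show 2 ≤ S.card by omega)
    have hle : ∀ U ⊆ S, ∑ i ∈ U, s i ≤ 1 := fun U hU =>
      (Finset.sum_le_sum_of_subset_of_nonneg hU (fun i _ _ => hs i)).trans hS
    obtain ⟨P, hP⟩ := ih (S \ T) (by rw [Finset.card_sdiff_of_subset hT]; omega)
      (hle _ Finset.sdiff_subset)
    have := hP.union (isPairing_single hTc (hle T hT)) Finset.sdiff_disjoint
    rw [Finset.sdiff_union_of_subset hT] at this
    exact ⟨_, this⟩

/-- An odd bin of cardinality at least 3 has an item of size at most 1/2 whose removal leaves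
a bin that splits into feasible pairs. -/
theorem exists_small_s14 {ι : Type*} [DecidableEq ι] {s : ι → ℝ} (hs : ∀ i, 0 ≤ s i)
    (B : Finset ι) (hB : ∑ i ∈ B, s i ≤ 1) (ho : Odd B.card) (hc : 3 ≤ B.card) :
    ∃ a ∈ B, s a ≤ 1 / 2 ∧ ∃ P, IsPairing s (B.erase a) P := by
  have : ∃ a ∈ B, s a ≤ 1 / 2 := by
    by_contra! h
    have h1 := Finset.card_nsmul_le_sum B s (1 / 2) (fun x hx => (h x hx).le)
    have h2 : (3 : ℝ) ≤ B.card := by exact_mod_cast hc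
    rw [nsmul_eq_mul] at h1
    linarith
  obtain ⟨a, ha, hsa⟩ := this
  obtain ⟨k, hk⟩ := ho
  refine ⟨a, ha, hsa, exists_isPairing hs k _ ?_ ?_⟩
  · rw [Finset.card_erase_of_mem ha]; omega
  · exact (Finset.sum_le_sum_of_subset_of_nonneg (Finset.erase_subset a B)
      (fun i _ _ => hs i)).trans hB

/-- Two disjoint bins `B`, `B'`, each of total size at most 1 and each of odd
cardinality at least 3, can be merged and repartitioned into `(|B|+|B'|)/2` pairs, each
pair of total size at most 1. -/
theorem merge_two_odd_bins_into_pairs {ι : Type*} [DecidableEq ι]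
    (s : ι → ℝ) (hs : ∀ i, 0 ≤ s i)
    (B B' : Finset ι) (hdisj : Disjoint B B')
    (hBsize : ∑ i ∈ B, s i ≤ 1) (hB'size : ∑ i ∈ B', s i ≤ 1)
    (hBodd : Odd B.card) (hBcard : 3 ≤ B.card)
    (hB'odd : Odd B'.card) (hB'card : 3 ≤ B'.card) :
    ∃ P : Finset (Finset ι),
      (∀ p ∈ P, p.card = 2 ∧ ∑ i ∈ p, s i ≤ 1) ∧
      (∀ p ∈ P, p ⊆ B ∪ B') ∧
      (∀ x ∈ B ∪ B', ∃! p, p ∈ P ∧ x ∈ p) ∧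
      P.card = (B.card + B'.card) / 2 := by
  obtain ⟨a, ha, hsa, P, hP⟩ := exists_small_s14 hs B hBsize hBodd hBcard
  obtain ⟨b, hb, hsb, Q, hQ⟩ := exists_small_s14 hs B' hB'size hB'odd hB'card
  have hd := Finset.disjoint_left.mp hdisj
  have hab : a ≠ b := by
    rintro rfl
    exact hd ha hb
  have h0 : IsPairing s {a, b} {{a, b}} := by
    refine isPairing_single (Finset.card_pair hab) ?_
    rw [Finset.sum_pair hab]
    linarith
  have h1 := hP.union hQ (hdisj.mono (Finset.erase_subset _ _) (Finset.erase_subset _ _))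
  have h2 := h1.union h0 (by
    rw [Finset.disjoint_left]
    intro x hx hx'
    simp only [Finset.mem_union, Finset.mem_erase, Finset.mem_insert,
      Finset.mem_singleton] at hx hx'
    rcases hx' with rfl | rfl
    · rcases hx with h | h
      · exact h.1 rfl
      · exact hd ha h.2
    · rcases hx with h | h
      · exact hd h.2 hb
      · exact h.1 rfl)
  have hU : (B.erase a ∪ B'.erase b) ∪ {a, b} = B ∪ B' := by
    ext x
    simp only [Finset.mem_union, Finset.mem_erase, Finset.mem_insert, Finset.mem_singleton]
    by_cases hxa : x = a
    · subst hxa; simp [ha]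
    · by_cases hxb : x = b
      · subst hxb; simp [hb]
      · simp [hxa, hxb]
  rw [hU] at h2
  obtain ⟨r1, r2, r3, r4⟩ := h2
  refine ⟨_, r1, r2, r3, ?_⟩
  rw [Finset.card_union_of_disjoint hdisj] at r4
  omega
end

section
/- Let T be a finite set of items with sizes in [0,1], and let a feasible partition of T into bins each of total size at most 1 be given, having exactly ρ singleton bins. Then there exists a feasible partition of T with the same multiset of bin cardinalities (hence the same cost for every cost function on cardinalities) in which the singleton bins are occupied by a set R of ρ items satisfying: every item of R has size at least the size of every item of T ∖ R. -/
open Finset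

/-- A permutation of `T` moving dominating items into `A`, never enlarging items outside `A`. -/
theorem exchange_perm {ι : Type*} [DecidableEq ι] (s : ι → ℚ) (T A : Finset ι) (hA : A ⊆ T) :
    ∃ σ : Equiv.Perm ι, (∀ x, σ x ∈ T ↔ x ∈ T) ∧ (∀ x, x ∉ A → s (σ x) ≤ s x) ∧
      ∀ i ∈ A, ∀ j ∈ T, j ∉ A → s (σ j) ≤ s (σ i) := by
  classical
  let S : Finset (Equiv.Perm T) := Finset.univ.filter
    fun τ => ∀ x, x ∉ A → s (Equiv.Perm.ofSubtype τ x) ≤ s x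
  have hS : S.Nonempty := ⟨1, by simp [S]⟩
  obtain ⟨τ, hτ, hmax⟩ := Finset.exists_max_image S
    (fun τ => ∑ x ∈ A, s (Equiv.Perm.ofSubtype τ x)) hS
  have hτ' : ∀ x, x ∉ A → s (Equiv.Perm.ofSubtype τ x) ≤ s x := by simpa [S] using hτ
  refine ⟨Equiv.Perm.ofSubtype τ, fun x => Equiv.Perm.ofSubtype_apply_mem_iff_mem τ x, hτ', ?_⟩
  intro i hi j hj hjA
  by_contra! hlt
  let τ' : Equiv.Perm T := τ * Equiv.swap ⟨i, hA hi⟩ ⟨j, hj⟩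
  have hne : i ≠ j := fun h => hjA (h ▸ hi)
  have hval : ∀ x, Equiv.Perm.ofSubtype τ' x = Equiv.Perm.ofSubtype τ (Equiv.swap i j x) := by
    intro x
    simp only [τ', map_mul, Equiv.Perm.mul_apply]
    congr 1
    rw [Equiv.Perm.ofSubtype_swap_eq]
  have hmem : τ' ∈ S := by
    simp only [S, Finset.mem_filter, Finset.mem_univ, true_and]
    intro x hx
    rw [hval]
    by_cases hxj : x = j
    · subst hxj
      rw [Equiv.swap_apply_right]
      exact hlt.le.trans (hτ' _ hx)
    · have hxi : x ≠ i := fun h => hx (h ▸ hi)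
      rw [Equiv.swap_apply_of_ne_of_ne hxi hxj]
      exact hτ' _ hx
  have hle := hmax τ' hmem
  refine absurd hle (not_le.mpr ?_)
  refine Finset.sum_lt_sum ?_ ⟨i, hi, ?_⟩
  · intro x hx
    rw [hval]
    have hxj : x ≠ j := fun h => hjA (h ▸ hx)
    by_cases hxi : x = i
    · subst hxi
      rw [Equiv.swap_apply_left]
      exact hlt.le
    · rw [Equiv.swap_apply_of_ne_of_ne hxi hxj]
  · rw [hval, Equiv.swap_apply_left]
    exact hlt

/-- (Exchange argument.) Given a feasible partition of `T` with exactly `ρ`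
singleton bins, there is a feasible partition of `T` with the same multiset of bin
cardinalities (hence the same cost for every cost function on cardinalities) whose
singleton bins are occupied by a set `R` of `ρ` items, each at least as large as every
item of `T ∖ R`. -/
theorem largest_items_in_singleton_bins {ι : Type*} [DecidableEq ι]
    (s : ι → ℚ) (hs : ∀ i, 0 ≤ s i ∧ s i ≤ 1)
    (T : Finset ι) (ρ : ℕ)
    (P : Finset (Finset ι))
    (hPne : ∀ b ∈ P, b.Nonempty)
    (hPsub : ∀ b ∈ P, b ⊆ T)
    (hPcover : ∀ x ∈ T, ∃! b, b ∈ P ∧ x ∈ b)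
    (hPfeas : ∀ b ∈ P, ∑ i ∈ b, s i ≤ 1)
    (hρ : (P.filter fun b => b.card = 1).card = ρ) :
    ∃ Q : Finset (Finset ι),
      (∀ b ∈ Q, b.Nonempty) ∧
      (∀ b ∈ Q, b ⊆ T) ∧
      (∀ x ∈ T, ∃! b, b ∈ Q ∧ x ∈ b) ∧
      (∀ b ∈ Q, ∑ i ∈ b, s i ≤ 1) ∧
      -- same multiset of bin cardinalities
      Q.val.map Finset.card = P.val.map Finset.card ∧
      -- the singleton bins of Q hold a set R of ρ items dominating all other items
      ∃ R : Finset ι,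
        R = (Q.filter fun b => b.card = 1).biUnion id ∧
        R.card = ρ ∧
        ∀ i ∈ R, ∀ j ∈ T \ R, s j ≤ s i := by
  classical
  have hdisj : ∀ b ∈ P, ∀ c ∈ P, ∀ x, x ∈ b → x ∈ c → b = c := fun b hb c hc x hxb hxc =>
    (hPcover x (hPsub b hb hxb)).unique ⟨hb, hxb⟩ ⟨hc, hxc⟩
  obtain ⟨σ, hσT, hσle, hσdom⟩ := exchange_perm s T ((P.filter fun b => b.card = 1).biUnion id)
    (by
      intro x hx
      simp only [Finset.mem_biUnion, Finset.mem_filter, id] at hx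
      obtain ⟨b, ⟨hb, -⟩, hxb⟩ := hx
      exact hPsub b hb hxb)
  have hmapmem : ∀ (b : Finset ι) x, x ∈ b.map σ.toEmbedding ↔ σ.symm x ∈ b := by
    intro b x
    simp [Finset.mem_map_equiv]
  have hRmem : ∀ x, x ∈ ((P.map (Finset.mapEmbedding σ.toEmbedding).toEmbedding).filter
      fun b => b.card = 1).biUnion id ↔
      σ.symm x ∈ (P.filter fun b => b.card = 1).biUnion id := by
    intro x
    simp only [Finset.mem_biUnion, Finset.mem_filter, id, Finset.mem_map]
    constructor
    · rintro ⟨_, ⟨⟨b, hb, rfl⟩, hc⟩, hx⟩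
      refine ⟨b, ⟨hb, ?_⟩, (hmapmem b x).1 hx⟩
      simpa using hc
    · rintro ⟨b, ⟨hb, hc⟩, hx⟩
      refine ⟨_, ⟨⟨b, hb, rfl⟩, ?_⟩, (hmapmem b x).2 hx⟩
      simpa using hc
  refine ⟨P.map (Finset.mapEmbedding σ.toEmbedding).toEmbedding, ?_, ?_, ?_, ?_, ?_, _, rfl, ?_, ?_⟩
  · intro b hb
    obtain ⟨c, hc, rfl⟩ := Finset.mem_map.1 hb
    exact (hPne c hc).map
  · intro b hb
    obtain ⟨c, hc, rfl⟩ := Finset.mem_map.1 hb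
    intro x hx
    have := (hσT _).2 (hPsub c hc ((hmapmem c x).1 hx))
    simpa using this
  · intro x hx
    have hx' : σ.symm x ∈ T := (hσT _).1 (by simpa using hx)
    obtain ⟨b, ⟨hb, hxb⟩, huniq⟩ := hPcover _ hx'
    refine ⟨_, ⟨Finset.mem_map_of_mem _ hb, (hmapmem b x).2 hxb⟩, ?_⟩
    rintro c ⟨hc, hxc⟩
    obtain ⟨d, hd, rfl⟩ := Finset.mem_map.1 hc
    rw [huniq d ⟨hd, (hmapmem d x).1 hxc⟩]
  · intro b hb
    obtain ⟨c, hc, rfl⟩ := Finset.mem_map.1 hb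
    change ∑ i ∈ c.map σ.toEmbedding, s i ≤ 1
    rw [Finset.sum_map]
    by_cases h1 : c.card = 1
    · obtain ⟨a, rfl⟩ := Finset.card_eq_one.1 h1
      simpa using (hs (σ a)).2
    · refine (Finset.sum_le_sum fun x hx => hσle x ?_).trans (hPfeas c hc)
      intro hxA
      simp only [Finset.mem_biUnion, Finset.mem_filter, id] at hxA
      obtain ⟨d, ⟨hd, hd1⟩, hxd⟩ := hxA
      exact h1 (hdisj d hd c hc x hxd hx ▸ hd1)
  · rw [Finset.map_val, Multiset.map_map]
    refine Multiset.map_congr rfl fun b _ => ?_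
    simp
  · have : (((P.map (Finset.mapEmbedding σ.toEmbedding).toEmbedding).filter
      fun b => b.card = 1).biUnion id) =
      ((P.filter fun b => b.card = 1).biUnion id).map σ.toEmbedding := by
      ext x
      rw [hRmem, hmapmem]
    rw [this, Finset.card_map, Finset.card_biUnion, ← hρ, Finset.card_eq_sum_ones]
    · exact Finset.sum_congr rfl fun b hb => (Finset.mem_filter.1 hb).2
    · intro b hb c hc hbc
      refine Finset.disjoint_left.2 fun x hxb hxc => hbc ?_
      exact hdisj b (Finset.mem_filter.1 hb).1 c (Finset.mem_filter.1 hc).1 x hxb hxc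
  · intro i hi j hj
    rw [Finset.mem_sdiff, hRmem] at hj
    have := hσdom _ ((hRmem i).1 hi) (σ.symm j) ((hσT _).1 (by simpa using hj.1)) hj.2
    simpa using this
end
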